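/- Let M be a spacelike surface in ℝ^{3,1} with a canonical normal null direction Z. Then, at each point p of M, K(p) = 0 and K_N(p) = 0 if and only if a(p) = 0 or β vanishes at p. -/

import Mathlib

noncomputable section

/-- Points of the parameter domain of the surface chart. -/
abbrev Pt : Type := ℝ × ℝ

/-- Vectors of the Minkowski space `ℝ^{3,1}`. -/
abbrev E4 : Type := Fin 4 → ℝ

/-- The Minkowski bilinear form of signature `(+,+,+,-)` on `ℝ⁴`. -/
def mink (v w : E4) : ℝ := v 0 * w 0 + v 1 * w 1 + v 2 * w 2 - v 3 * w 3

/-- Realization in `ℝ^{3,1}` of a coordinate vector field `X` along the immersion `ψ`. -/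
def vecF (ψ : Pt → E4) (X : Pt → Pt) : Pt → E4 := fun p => fderiv ℝ ψ p (X p)

/-- Flat (ambient) derivative of an `ℝ⁴`-valued field along a coordinate vector field. -/
def Dflat (X : Pt → Pt) (V : Pt → E4) : Pt → E4 := fun p => fderiv ℝ V p (X p)

/-- Second fundamental form `B(X,Y) = ∇̄_X Y − ∇_X Y`. -/
def sff (ψ : Pt → E4) (conn : (Pt → Pt) → (Pt → Pt) → Pt → Pt) (X Y : Pt → Pt) : Pt → E4 :=
  fun p => Dflat X (vecF ψ Y) p - vecF ψ (conn X Y) p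

/-- `v` is tangent to the surface at `p`. -/
def isTangentV (ψ : Pt → E4) (p : Pt) (v : E4) : Prop := ∃ w : Pt, fderiv ℝ ψ p w = v

/-- `v` is normal to the surface at `p`. -/
def isNormalV (ψ : Pt → E4) (p : Pt) (v : E4) : Prop := ∀ w : Pt, mink v (fderiv ℝ ψ p w) = 0

/-- Lie bracket of coordinate vector fields on the chart. -/
def lieB (X Y : Pt → Pt) : Pt → Pt := fun p => fderiv ℝ Y p (X p) - fderiv ℝ X p (Y p)

/-- Curvature tensor `R(X,Y)V = ∇_Y∇_X V − ∇_X∇_Y V + ∇_{[X,Y]}V`. -/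
def curvR (conn : (Pt → Pt) → (Pt → Pt) → Pt → Pt) (X Y V : Pt → Pt) : Pt → Pt :=
  fun p => conn Y (conn X V) p - conn X (conn Y V) p + conn (lieB X Y) V p

/-- Normal curvature tensor `R^⊥(X,Y)ν = ∇⊥_Y∇⊥_X ν − ∇⊥_X∇⊥_Y ν + ∇⊥_{[X,Y]}ν`. -/
def curvRperp (nconn : (Pt → Pt) → (Pt → E4) → Pt → E4) (X Y : Pt → Pt) (ν : Pt → E4) :
    Pt → E4 :=
  fun p => nconn Y (nconn X ν) p - nconn X (nconn Y ν) p + nconn (lieB X Y) ν p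

/-- Determinant of four vectors of `ℝ⁴` (the volume form `e₁∧e₂∧e₃∧e₄ ↦ 1`). -/
def det4 (a b c d : E4) : ℝ := Matrix.det (Matrix.of ![a, b, c, d])

/-- A spacelike surface in `ℝ^{3,1}`, given by a chart `ψ : U → ℝ^{3,1}`, endowed with a
canonical normal null direction with respect to the constant unit spacelike vector `Z`,
together with all the associated geometric data: the Levi-Civita connection `conn`,
the normal connection `nconn`, the tangent part `Z^⊤` (coordinates `ZT`), the oriented
orthonormal completion `W` (coordinates `Wc`), the shape operator `shA = A_{Z^⊥}`,
the 1-form `β` with `B(X,Z^⊤) = β(X)Z^⊥`, and the lightlike normal field `W'` with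
`⟨Z^⊥,W'⟩ = 1`.  Each piece of data is characterized by its defining property. -/
structure CNND where
  U : Set Pt
  hUopen : IsOpen U
  ψ : Pt → E4
  hψ : ContDiffOn ℝ (⊤ : ℕ∞) ψ U
  himm : ∀ p ∈ U, ∀ v : Pt, fderiv ℝ ψ p v = 0 → v = 0
  hspacelike : ∀ p ∈ U, ∀ v : Pt, v ≠ 0 → 0 < mink (fderiv ℝ ψ p v) (fderiv ℝ ψ p v)
  /-- Levi-Civita connection of the induced metric, as the tangent part of the flat one. -/
  conn : (Pt → Pt) → (Pt → Pt) → Pt → Pt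
  hconn : ∀ X Y, ∀ p ∈ U, DifferentiableAt ℝ (vecF ψ Y) p → isNormalV ψ p (sff ψ conn X Y p)
  hconnSmooth : ∀ X Y, ContDiffOn ℝ (⊤ : ℕ∞) X U → ContDiffOn ℝ (⊤ : ℕ∞) Y U → ContDiffOn ℝ (⊤ : ℕ∞) (conn X Y) U
  /-- Normal connection: the normal part of the flat derivative of a normal field. -/
  nconn : (Pt → Pt) → (Pt → E4) → Pt → E4
  hnconn : ∀ X ν, ∀ p ∈ U, (∀ q ∈ U, isNormalV ψ q (ν q)) → DifferentiableAt ℝ ν p →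
    isNormalV ψ p (nconn X ν p) ∧ isTangentV ψ p (Dflat X ν p - nconn X ν p)
  hnconnSmooth : ∀ X ν, ContDiffOn ℝ (⊤ : ℕ∞) X U → (∀ q ∈ U, isNormalV ψ q (ν q)) →
    ContDiffOn ℝ (⊤ : ℕ∞) ν U → ContDiffOn ℝ (⊤ : ℕ∞) (nconn X ν) U
  /-- The parallel (constant) vector field `Z`, a unit spacelike vector. -/
  Z : E4
  hZunit : mink Z Z = 1
  /-- Coordinates of the tangent part `Z^⊤` of `Z`; `Z^⊥ = Z − Z^⊤` is normal. -/
  ZT : Pt → Pt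
  hZTsmooth : ContDiffOn ℝ (⊤ : ℕ∞) ZT U
  hZTtangentpart : ∀ p ∈ U, isNormalV ψ p (Z - fderiv ℝ ψ p (ZT p))
  /-- canonical normal null direction: `Z^⊥` is lightlike … -/
  hZperpNull : ∀ p ∈ U, mink (Z - fderiv ℝ ψ p (ZT p)) (Z - fderiv ℝ ψ p (ZT p)) = 0
  /-- … and nowhere zero. -/
  hZperpNe : ∀ p ∈ U, Z - fderiv ℝ ψ p (ZT p) ≠ 0
  /-- Coordinates of the unit tangent field `W` orthogonal to `Z^⊤`, positively oriented. -/
  Wc : Pt → Pt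
  hWsmooth : ContDiffOn ℝ (⊤ : ℕ∞) Wc U
  hWunit : ∀ p ∈ U, mink (fderiv ℝ ψ p (Wc p)) (fderiv ℝ ψ p (Wc p)) = 1
  hWorth : ∀ p ∈ U, mink (fderiv ℝ ψ p (ZT p)) (fderiv ℝ ψ p (Wc p)) = 0
  hWorient : ∀ p ∈ U, 0 < (ZT p).1 * (Wc p).2 - (ZT p).2 * (Wc p).1
  /-- The shape operator `A_{Z^⊥}`: `⟨A_{Z^⊥}X, Y⟩ = ⟨B(X,Y), Z^⊥⟩`. -/
  shA : (Pt → Pt) → Pt → Pt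
  hshA : ∀ X Y, ∀ p ∈ U, DifferentiableAt ℝ (vecF ψ Y) p →
    mink (fderiv ℝ ψ p (shA X p)) (fderiv ℝ ψ p (Y p)) =
      mink (sff ψ conn X Y p) (Z - fderiv ℝ ψ p (ZT p))
  /-- The 1-form `β` with `B(X, Z^⊤) = β(X) Z^⊥`. -/
  beta : Pt → Pt → ℝ
  hbeta : ∀ X, ∀ p ∈ U, sff ψ conn X ZT p = beta p (X p) • (Z - fderiv ℝ ψ p (ZT p))
  /-- The lightlike normal field `W'` with `⟨Z^⊥, W'⟩ = 1`, such that
  `(Z^⊤, W, (Z^⊥+W')/√2, (Z^⊥−W')/√2)` is a positively oriented orthonormal frame. -/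
  Wp : Pt → E4
  hWpNormal : ∀ p ∈ U, isNormalV ψ p (Wp p)
  hWpNull : ∀ p ∈ U, mink (Wp p) (Wp p) = 0
  hWpPair : ∀ p ∈ U, mink (Z - fderiv ℝ ψ p (ZT p)) (Wp p) = 1
  hWpOrient : ∀ p ∈ U, 0 < det4 (fderiv ℝ ψ p (ZT p)) (fderiv ℝ ψ p (Wc p))
    ((Real.sqrt 2)⁻¹ • ((Z - fderiv ℝ ψ p (ZT p)) + Wp p))
    ((Real.sqrt 2)⁻¹ • ((Z - fderiv ℝ ψ p (ZT p)) - Wp p))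

namespace CNND

variable (S : CNND)

/-- The normal part `Z^⊥` of `Z` along the surface. -/
def Zperp : Pt → E4 := fun p => S.Z - fderiv ℝ S.ψ p (S.ZT p)

/-- The second fundamental form of the surface. -/
def B : (Pt → Pt) → (Pt → Pt) → Pt → E4 := sff S.ψ S.conn

/-- The function `a = α(W) = ⟨B(W,W), Z^⊥⟩`. -/
def afun : Pt → ℝ := fun p => mink (S.B S.Wc S.Wc p) (S.Zperp p)

/-- The 1-form `α(X) = ⟨B(X,W), Z^⊥⟩`. -/
def alphaF (X : Pt → Pt) : Pt → ℝ := fun p => mink (S.B X S.Wc p) (S.Zperp p)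

/-- The mean curvature vector `H⃗ = (1/2)(B(Z^⊤,Z^⊤) + B(W,W))`. -/
def Hvec : Pt → E4 := fun p => (1 / 2 : ℝ) • (S.B S.ZT S.ZT p + S.B S.Wc S.Wc p)

/-- The Gauss curvature `K = ⟨R(Z^⊤,W)Z^⊤, W⟩`. -/
def Kfun : Pt → ℝ := fun p =>
  mink (fderiv ℝ S.ψ p (curvR S.conn S.ZT S.Wc S.ZT p)) (fderiv ℝ S.ψ p (S.Wc p))

/-- The normal curvature `K_N = ⟨R^⊥(Z^⊤,W)Z^⊥, W'⟩`. -/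
def KNfun : Pt → ℝ := fun p => mink (curvRperp S.nconn S.ZT S.Wc S.Zperp p) (S.Wp p)

end CNND

/-- The wedge `v ∧ w` of two vectors of `ℝ⁴`, as an antisymmetric matrix (bivector). -/
def wedge2 (v w : E4) : Fin 4 → Fin 4 → ℝ := fun i j => v i * w j - v j * w i

/-- The Gauss map `G = Z^⊤ ∧ W : M → Λ²ℝ^{3,1}`. -/
def CNND.Gmap (S : CNND) : Pt → Fin 4 → Fin 4 → ℝ :=
  fun p => wedge2 (fderiv ℝ S.ψ p (S.ZT p)) (fderiv ℝ S.ψ p (S.Wc p))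

/-- The signs of the Minkowski metric. -/
def epsM : Fin 4 → ℝ := fun i => if i = 3 then -1 else 1

/-- The induced (signature `(3,3)`) inner product on bivectors of `ℝ^{3,1}`:
`⟨v∧w, v'∧w'⟩ = ⟨v,v'⟩⟨w,w'⟩ − ⟨v,w'⟩⟨w,v'⟩`. -/
def binner (η η' : Fin 4 → Fin 4 → ℝ) : ℝ :=
  (1 / 2) * ∑ i : Fin 4, ∑ j : Fin 4, epsM i * epsM j * η i j * η' i j

/-- The wedge product `Λ²ℝ^{3,1} × Λ²ℝ^{3,1} → Λ⁴ℝ^{3,1} ≅ ℝ`, normalized so that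
`(v∧w)∧(v'∧w') = det(v,w,v',w')`. -/
def bwedge (η η' : Fin 4 → Fin 4 → ℝ) : ℝ :=
  (1 / 4) * ∑ σ : Equiv.Perm (Fin 4),
    ((Equiv.Perm.sign σ : ℤ) : ℝ) * η (σ 0) (σ 1) * η' (σ 2) (σ 3)

/-- The `ℂ`-bilinear form `H(η,η') = ⟨η,η'⟩ + i η∧η'` on bivectors, where `i = −⋆`. -/
def HformC (η η' : Fin 4 → Fin 4 → ℝ) : ℂ :=
  (binner η η' : ℝ) + (bwedge η η' : ℝ) * Complex.I

/-- The quadratic form `δ(u) = dG(u) ∧ dG(u)` whose zero directions are the asymptotic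
directions. -/
def CNND.deltaQ (S : CNND) (p : Pt) (u : Pt) : ℝ :=
  bwedge (fderiv ℝ S.Gmap p u) (fderiv ℝ S.Gmap p u)

lemma mink_comm (v w : E4) : mink v w = mink w v := by
  simp only [mink]; ring

lemma mink_add_left (u v w : E4) : mink (u + v) w = mink u w + mink v w := by
  simp only [mink, Pi.add_apply]; ring

lemma mink_sub_left (u v w : E4) : mink (u - v) w = mink u w - mink v w := by
  simp only [mink, Pi.sub_apply]; ring

lemma mink_smul_left (c : ℝ) (v w : E4) : mink (c • v) w = c * mink v w := by
  simp only [mink, Pi.smul_apply, smul_eq_mul]; ring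

lemma mink_neg_left (v w : E4) : mink (-v) w = -mink v w := by
  simp only [mink, Pi.neg_apply]; ring

lemma mink_zero_left (w : E4) : mink 0 w = 0 := by
  simp [mink]

/-- Leibniz rule for two fields whose Minkowski product is locally constant. -/
lemma mink_fderiv_add_eq_zero {f g : Pt → E4} {p : Pt} {c : ℝ} (hf : DifferentiableAt ℝ f p)
    (hg : DifferentiableAt ℝ g p) (h : ∀ᶠ q in nhds p, mink (f q) (g q) = c) (x : Pt) :
    mink (fderiv ℝ f p x) (g p) + mink (f p) (fderiv ℝ g p x) = 0 := by
  have hF (i : Fin 4) := hasFDerivAt_pi'.1 hf.hasFDerivAt i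
  have hG (i : Fin 4) := hasFDerivAt_pi'.1 hg.hasFDerivAt i
  have key := ((((hF 0).mul (hG 0)).add ((hF 1).mul (hG 1))).add ((hF 2).mul (hG 2))).sub
    ((hF 3).mul (hG 3))
  have hc := (hasFDerivAt_const (𝕜 := ℝ) c p).congr_of_eventuallyEq h
  have := congrArg (fun L : Pt →L[ℝ] ℝ => L x) (key.unique hc)
  simp at this
  simp only [mink]
  linarith

/-- Flatness of the ambient connection. -/
lemma Dflat_comm {V : Pt → E4} {X Y : Pt → Pt} {p : Pt} (hV : ContDiffAt ℝ (⊤ : ℕ∞) V p)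
    (hX : DifferentiableAt ℝ X p) (hY : DifferentiableAt ℝ Y p) :
    Dflat Y (Dflat X V) p - Dflat X (Dflat Y V) p + Dflat (lieB X Y) V p = 0 := by
  have hd : DifferentiableAt ℝ (fderiv ℝ V) p :=
    (hV.fderiv_right (m := 1) (by norm_cast)).differentiableAt (by simp)
  have hs : IsSymmSndFDerivAt ℝ V p := hV.isSymmSndFDerivAt (by simp; norm_cast)
  have h1 : ∀ A B : Pt → Pt, DifferentiableAt ℝ A p → Dflat B (Dflat A V) p =
      fderiv ℝ (fderiv ℝ V) p (B p) (A p) + fderiv ℝ V p (fderiv ℝ A p (B p)) := by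
    intro A B hA
    unfold Dflat
    rw [fderiv_clm_apply hd hA]
    simp [add_comm]
  rw [h1 X Y hX, h1 Y X hY, hs.eq (X p) (Y p)]
  simp only [Dflat, lieB, map_sub]
  abel

lemma ContDiffOn.dflat {V : Pt → E4} {X : Pt → Pt} {U : Set Pt} (hU : IsOpen U)
    (hV : ContDiffOn ℝ (⊤ : ℕ∞) V U) (hX : ContDiffOn ℝ (⊤ : ℕ∞) X U) :
    ContDiffOn ℝ (⊤ : ℕ∞) (Dflat X V) U :=
  (hV.fderiv_of_isOpen hU (by norm_cast)).clm_apply hX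

lemma ContDiffOn.differentiableAt_of_isOpen {E : Type*} [NormedAddCommGroup E] [NormedSpace ℝ E]
    {V : Pt → E} {U : Set Pt} (hU : IsOpen U) (hV : ContDiffOn ℝ (⊤ : ℕ∞) V U) {p : Pt}
    (hp : p ∈ U) : DifferentiableAt ℝ V p :=
  (hV.contDiffAt (hU.mem_nhds hp)).differentiableAt (by simp)

/-- Two vectors of the plane with nonzero determinant span it. -/
lemma exists_eq_smul_add_smul {e f : Pt} (h : e.1 * f.2 - e.2 * f.1 ≠ 0) (v : Pt) :
    ∃ x y : ℝ, v = x • e + y • f := by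
  refine ⟨(v.1 * f.2 - v.2 * f.1) / (e.1 * f.2 - e.2 * f.1),
    (e.1 * v.2 - e.2 * v.1) / (e.1 * f.2 - e.2 * f.1), ?_⟩
  ext
  · simp only [Prod.fst_add, Prod.smul_fst, smul_eq_mul]
    rw [div_mul_eq_mul_div, div_mul_eq_mul_div, ← add_div, eq_div_iff h]
    ring
  · simp only [Prod.snd_add, Prod.smul_snd, smul_eq_mul]
    rw [div_mul_eq_mul_div, div_mul_eq_mul_div, ← add_div, eq_div_iff h]
    ring

namespace CNND

variable (S : CNND)

lemma contDiffOn_vecF {X : Pt → Pt} (hX : ContDiffOn ℝ (⊤ : ℕ∞) X S.U) :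
    ContDiffOn ℝ (⊤ : ℕ∞) (vecF S.ψ X) S.U :=
  S.hψ.dflat S.hUopen hX

lemma contDiffOn_Zperp : ContDiffOn ℝ (⊤ : ℕ∞) S.Zperp S.U :=
  contDiffOn_const.sub (S.contDiffOn_vecF S.hZTsmooth)

variable {S} {p : Pt}

lemma fderiv_Zperp (x : Pt) :
    fderiv ℝ S.Zperp p x = -fderiv ℝ (vecF S.ψ S.ZT) p x := by
  have h : S.Zperp = fun q => S.Z - vecF S.ψ S.ZT q := rfl
  rw [h, fderiv_const_sub]
  rfl

lemma eq_zero_of_tangent_of_normal (hp : p ∈ S.U) {v : E4} (ht : isTangentV S.ψ p v)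
    (hn : isNormalV S.ψ p v) : v = 0 := by
  obtain ⟨w, rfl⟩ := ht
  by_cases hw : w = 0
  · simp [hw]
  · exact absurd (hn w) (S.hspacelike p hp w hw).ne'

lemma mink_ZT_self (hp : p ∈ S.U) : mink (vecF S.ψ S.ZT p) (vecF S.ψ S.ZT p) = 1 := by
  have h1 := S.hZTtangentpart p hp (S.ZT p)
  have h2 := S.hZperpNull p hp
  have h3 := S.hZunit
  simp only [vecF, mink, Pi.sub_apply] at *
  linarith

/-- Torsion-freeness: the normal part of the second derivative is symmetric. -/
lemma mink_Dflat_vecF_symm (hp : p ∈ S.U) {X Y : Pt → Pt} (hX : ContDiffOn ℝ (⊤ : ℕ∞) X S.U)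
    (hY : ContDiffOn ℝ (⊤ : ℕ∞) Y S.U) {ν : E4} (hν : isNormalV S.ψ p ν) :
    mink (Dflat X (vecF S.ψ Y) p) ν = mink (Dflat Y (vecF S.ψ X) p) ν := by
  have h := Dflat_comm (S.hψ.contDiffAt (S.hUopen.mem_nhds hp))
    (hX.differentiableAt_of_isOpen S.hUopen hp) (hY.differentiableAt_of_isOpen S.hUopen hp)
  have h0 := congrArg (fun v => mink v ν) h
  simp only [mink_add_left, mink_sub_left, mink_zero_left] at h0
  have h1 : mink (Dflat (lieB X Y) S.ψ p) ν = 0 := by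
    rw [mink_comm]; exact hν _
  have e : ∀ A, Dflat A S.ψ = vecF S.ψ A := fun A => rfl
  rw [h1, e, e] at h0
  linarith

lemma Dflat_ZT (hp : p ∈ S.U) (X : Pt → Pt) : Dflat X (vecF S.ψ S.ZT) p =
    vecF S.ψ (S.conn X S.ZT) p + S.beta p (X p) • S.Zperp p := by
  have h := S.hbeta X p hp
  rw [sff, sub_eq_iff_eq_add] at h
  rw [h, add_comm]; rfl

lemma beta_eq_mink (hp : p ∈ S.U) (v : Pt) :
    S.beta p v = mink (fderiv ℝ (vecF S.ψ S.ZT) p v) (S.Wp p) := by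
  have h1 : mink (S.Zperp p) (S.Wp p) = 1 := S.hWpPair p hp
  have h2 : mink (S.Wp p) (vecF S.ψ (S.conn (fun _ => v) S.ZT) p) = 0 := S.hWpNormal p hp _
  have h := Dflat_ZT hp fun _ => v
  rw [Dflat] at h
  rw [h, mink_add_left, mink_smul_left, h1, mink_comm, h2]
  ring

lemma mink_Zperp_vecF (hp : p ∈ S.U) (X : Pt → Pt) : mink (S.Zperp p) (vecF S.ψ X p) = 0 :=
  S.hZTtangentpart p hp (X p)

/-- `⟨∇_X Z^⊤, W⟩ = ⟨∇̄_X W, Z^⊥⟩`. -/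
lemma mink_Dflat_ZT_Wc (hp : p ∈ S.U) (X : Pt → Pt) :
    mink (Dflat X (vecF S.ψ S.ZT) p) (vecF S.ψ S.Wc p) =
      mink (Dflat X (vecF S.ψ S.Wc) p) (S.Zperp p) := by
  have h := mink_fderiv_add_eq_zero
    (S.contDiffOn_Zperp.differentiableAt_of_isOpen S.hUopen hp)
    ((S.contDiffOn_vecF S.hWsmooth).differentiableAt_of_isOpen S.hUopen hp)
    (Filter.eventually_of_mem (S.hUopen.mem_nhds hp) fun q hq => mink_Zperp_vecF hq S.Wc) (X p)
  rw [fderiv_Zperp, mink_neg_left, mink_comm (S.Zperp p)] at h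
  simp only [Dflat]
  linarith

lemma mink_Dflat_Wc_Wc (hp : p ∈ S.U) :
    mink (Dflat S.Wc (vecF S.ψ S.Wc) p) (S.Zperp p) = S.afun p := by
  have h := mink_Zperp_vecF hp (S.conn S.Wc S.Wc)
  rw [afun, B, sff, mink_sub_left, mink_comm (vecF _ _ _), h, sub_zero]

lemma mink_Dflat_ZT_Wc_Zperp (hp : p ∈ S.U) :
    mink (Dflat S.ZT (vecF S.ψ S.Wc) p) (S.Zperp p) = 0 := by
  have hn : isNormalV S.ψ p (S.Zperp p) := S.hZTtangentpart p hp
  rw [mink_Dflat_vecF_symm hp S.hZTsmooth S.hWsmooth hn, Dflat_ZT hp,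
    mink_add_left, mink_comm (vecF _ _ _), mink_Zperp_vecF hp, mink_smul_left]
  have := S.hZperpNull p hp
  simp only [Zperp, this]
  ring

/-- `∇_X Z^⊤ = ⟨∇̄_X W, Z^⊥⟩ W`. -/
lemma conn_ZT (hp : p ∈ S.U) (X : Pt → Pt) :
    S.conn X S.ZT p = mink (Dflat X (vecF S.ψ S.Wc) p) (S.Zperp p) • S.Wc p := by
  obtain ⟨x, y, hxy⟩ := exists_eq_smul_add_smul (S.hWorient p hp).ne' (S.conn X S.ZT p)
  have hd := (S.contDiffOn_vecF S.hZTsmooth).differentiableAt_of_isOpen S.hUopen hp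
  have h := mink_fderiv_add_eq_zero hd hd
    (Filter.eventually_of_mem (S.hUopen.mem_nhds hp) fun q hq => mink_ZT_self hq) (X p)
  have hT : mink (Dflat X (vecF S.ψ S.ZT) p) (vecF S.ψ S.ZT p) = 0 := by
    rw [mink_comm (vecF _ _ _)] at h
    simp only [Dflat]
    linarith
  have hW := mink_Dflat_ZT_Wc hp X
  have hv : vecF S.ψ (S.conn X S.ZT) p = x • vecF S.ψ S.ZT p + y • vecF S.ψ S.Wc p := by
    simp only [vecF, hxy, map_add, map_smul]
  have h0 : mink (vecF S.ψ S.ZT p) (vecF S.ψ S.Wc p) = 0 := S.hWorth p hp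
  have h1 : mink (vecF S.ψ S.Wc p) (vecF S.ψ S.Wc p) = 1 := S.hWunit p hp
  rw [Dflat_ZT hp, hv] at hT hW
  simp only [mink_add_left, mink_smul_left, mink_Zperp_vecF hp, mink_ZT_self hp, h0, h1,
    mink_comm (vecF S.ψ S.Wc p) (vecF S.ψ S.ZT p)] at hT hW
  have hx : x = 0 := by linarith
  have hy : y = mink (Dflat X (vecF S.ψ S.Wc) p) (S.Zperp p) := by linarith
  rw [hxy, hx, hy]
  simp

lemma mink_vecF_conn (hp : p ∈ S.U) (X : Pt → Pt) {Y : Pt → Pt}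
    (hY : ContDiffOn ℝ (⊤ : ℕ∞) Y S.U) (V : Pt → Pt) :
    mink (vecF S.ψ (S.conn X Y) p) (vecF S.ψ V p) =
      mink (Dflat X (vecF S.ψ Y) p) (vecF S.ψ V p) := by
  have h := S.hconn X Y p hp
    ((S.contDiffOn_vecF hY).differentiableAt_of_isOpen S.hUopen hp) (V p)
  rw [sff, mink_sub_left] at h
  simp only [vecF] at *
  linarith

lemma mink_Dflat_conn_ZT (hp : p ∈ S.U) {X : Pt → Pt} (hX : ContDiffOn ℝ (⊤ : ℕ∞) X S.U)
    (Y : Pt → Pt) :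
    mink (Dflat Y (vecF S.ψ (S.conn X S.ZT)) p) (vecF S.ψ S.Wc p) =
      mink (Dflat Y (Dflat X (vecF S.ψ S.ZT)) p) (vecF S.ψ S.Wc p) +
        S.beta p (X p) * mink (Dflat Y (vecF S.ψ S.Wc) p) (S.Zperp p) := by
  have hD := ((S.contDiffOn_vecF S.hZTsmooth).dflat S.hUopen hX).differentiableAt_of_isOpen
    S.hUopen hp
  have hC := (S.contDiffOn_vecF (S.hconnSmooth X S.ZT hX S.hZTsmooth)).differentiableAt_of_isOpen
    S.hUopen hp
  have h := mink_fderiv_add_eq_zero (hD.sub hC)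
    ((S.contDiffOn_vecF S.hWsmooth).differentiableAt_of_isOpen S.hUopen hp)
    (Filter.eventually_of_mem (S.hUopen.mem_nhds hp) fun q hq => by
      rw [Pi.sub_apply, Dflat_ZT hq, add_sub_cancel_left, mink_smul_left, mink_Zperp_vecF hq,
        mul_zero]) (Y p)
  rw [fderiv_sub hD hC, Pi.sub_apply, Dflat_ZT hp, add_sub_cancel_left, mink_smul_left,
    sub_apply, mink_sub_left, mink_comm (S.Zperp p)] at h
  simp only [Dflat] at *
  linarith

/-- Gauss equation: `K = a β(Z^⊤)`. -/
lemma Kfun_eq (hp : p ∈ S.U) : S.Kfun p = S.afun p * S.beta p (S.ZT p) := by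
  have hT := S.hZTsmooth
  have hW := S.hWsmooth
  have hflat := congrArg (fun v => mink v (vecF S.ψ S.Wc p))
    (Dflat_comm ((S.contDiffOn_vecF hT).contDiffAt (S.hUopen.mem_nhds hp))
      (hT.differentiableAt_of_isOpen S.hUopen hp) (hW.differentiableAt_of_isOpen S.hUopen hp))
  simp only [mink_add_left, mink_sub_left, mink_zero_left] at hflat
  have h1 := mink_vecF_conn hp S.Wc (S.hconnSmooth _ _ hT hT) S.Wc
  have h2 := mink_vecF_conn hp S.ZT (S.hconnSmooth _ _ hW hT) S.Wc
  have h3 := mink_vecF_conn hp (lieB S.ZT S.Wc) hT S.Wc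
  rw [mink_Dflat_conn_ZT hp hT, mink_Dflat_Wc_Wc hp] at h1
  rw [mink_Dflat_conn_ZT hp hW, mink_Dflat_ZT_Wc_Zperp hp] at h2
  have hK : S.Kfun p = mink (vecF S.ψ (S.conn S.Wc (S.conn S.ZT S.ZT)) p) (vecF S.ψ S.Wc p) -
      mink (vecF S.ψ (S.conn S.ZT (S.conn S.Wc S.ZT)) p) (vecF S.ψ S.Wc p) +
      mink (vecF S.ψ (S.conn (lieB S.ZT S.Wc) S.ZT) p) (vecF S.ψ S.Wc p) := by
    simp only [Kfun, curvR, vecF, map_add, map_sub, mink_add_left, mink_sub_left]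
  rw [hK, h1, h2, h3]
  linarith

lemma mink_nconn (hp : p ∈ S.U) (X : Pt → Pt) {ν : Pt → E4}
    (hν : ContDiffOn ℝ (⊤ : ℕ∞) ν S.U) (hn : ∀ q ∈ S.U, isNormalV S.ψ q (ν q)) {μ : E4}
    (hμ : isNormalV S.ψ p μ) : mink (S.nconn X ν p) μ = mink (Dflat X ν p) μ := by
  obtain ⟨w, hw⟩ := (S.hnconn X ν p hp hn (hν.differentiableAt_of_isOpen S.hUopen hp)).2
  have := hμ w
  rw [hw, mink_comm, mink_sub_left] at this
  linarith

lemma nconn_Zperp (hp : p ∈ S.U) (X : Pt → Pt) :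
    S.nconn X S.Zperp p = Dflat X S.Zperp p + vecF S.ψ (S.conn X S.ZT) p := by
  obtain ⟨hn, w, hw⟩ := S.hnconn X S.Zperp p hp S.hZTtangentpart
    (S.contDiffOn_Zperp.differentiableAt_of_isOpen S.hUopen hp)
  have hD : Dflat X S.Zperp p =
      -(vecF S.ψ (S.conn X S.ZT) p + S.beta p (X p) • S.Zperp p) := by
    rw [← Dflat_ZT hp]; exact fderiv_Zperp _
  rw [← sub_eq_zero]
  refine eq_zero_of_tangent_of_normal hp ⟨-w - S.conn X S.ZT p, ?_⟩ fun v => ?_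
  · rw [map_sub, map_neg, hw]
    simp only [vecF]
    abel
  · rw [hD, mink_sub_left, hn v, mink_add_left, mink_neg_left, mink_add_left, mink_smul_left,
      show mink (S.Zperp p) (fderiv ℝ S.ψ p v) = 0 from S.hZTtangentpart p hp v]
    ring

lemma mink_Dflat_nconn_Zperp (hp : p ∈ S.U) {X Y : Pt → Pt}
    (hX : ContDiffOn ℝ (⊤ : ℕ∞) X S.U) (hY : ContDiffOn ℝ (⊤ : ℕ∞) Y S.U) {μ : E4}
    (hμ : isNormalV S.ψ p μ) :
    mink (Dflat Y (S.nconn X S.Zperp) p) μ = mink (Dflat Y (Dflat X S.Zperp) p) μ +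
      mink (Dflat X (vecF S.ψ S.Wc) p) (S.Zperp p) * mink (Dflat S.Wc (vecF S.ψ Y) p) μ := by
  have hC := S.hconnSmooth X S.ZT hX S.hZTsmooth
  have hev : S.nconn X S.Zperp =ᶠ[nhds p] Dflat X S.Zperp + vecF S.ψ (S.conn X S.ZT) :=
    Filter.eventually_of_mem (S.hUopen.mem_nhds hp) fun q hq => nconn_Zperp hq X
  have h := mink_Dflat_vecF_symm hp hY hC hμ
  have h' : Dflat (S.conn X S.ZT) (vecF S.ψ Y) p =
      mink (Dflat X (vecF S.ψ S.Wc) p) (S.Zperp p) • Dflat S.Wc (vecF S.ψ Y) p := by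
    rw [Dflat, conn_ZT hp, map_smul]; rfl
  rw [h', mink_smul_left] at h
  rw [← h, ← mink_add_left]
  congr 1
  rw [Dflat, hev.fderiv_eq, fderiv_add
    ((S.contDiffOn_Zperp.dflat S.hUopen hX).differentiableAt_of_isOpen S.hUopen hp)
    ((S.contDiffOn_vecF hC).differentiableAt_of_isOpen S.hUopen hp)]
  rfl

/-- Ricci equation: `K_N = -a β(W)`. -/
lemma KNfun_eq (hp : p ∈ S.U) : S.KNfun p = -(S.afun p * S.beta p (S.Wc p)) := by
  have hT := S.hZTsmooth
  have hW := S.hWsmooth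
  have hZ := S.contDiffOn_Zperp
  have hμ := S.hWpNormal p hp
  have hN : ∀ q ∈ S.U, isNormalV S.ψ q (S.Zperp q) := S.hZTtangentpart
  have hn : ∀ X, ∀ q ∈ S.U, isNormalV S.ψ q (S.nconn X S.Zperp q) := fun X q hq =>
    (S.hnconn X S.Zperp q hq hN (hZ.differentiableAt_of_isOpen S.hUopen hq)).1
  have hflat := congrArg (fun v => mink v (S.Wp p))
    (Dflat_comm (hZ.contDiffAt (S.hUopen.mem_nhds hp))
      (hT.differentiableAt_of_isOpen S.hUopen hp) (hW.differentiableAt_of_isOpen S.hUopen hp))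
  simp only [mink_add_left, mink_sub_left, mink_zero_left] at hflat
  have hpair : mink (Dflat S.Wc (vecF S.ψ S.ZT) p) (S.Wp p) = S.beta p (S.Wc p) :=
    (beta_eq_mink hp _).symm
  rw [KNfun, curvRperp, mink_add_left, mink_sub_left,
    mink_nconn hp S.Wc (S.hnconnSmooth _ _ hT hN hZ) (hn _) hμ,
    mink_nconn hp S.ZT (S.hnconnSmooth _ _ hW hN hZ) (hn _) hμ,
    mink_nconn hp (lieB S.ZT S.Wc) hZ hN hμ,
    mink_Dflat_nconn_Zperp hp hT hW hμ, mink_Dflat_nconn_Zperp hp hW hT hμ,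
    mink_Dflat_ZT_Wc_Zperp hp, mink_Dflat_Wc_Wc hp, hpair]
  linarith

end CNND

/-- At each point `p` of `M`, `K(p) = 0` and `K_N(p) = 0` if and only if
`a(p) = 0` or `β` vanishes at `p`. -/
theorem cnnd_flat_iff_a_or_beta_zero (S : CNND) :
    ∀ p ∈ S.U,
      ((S.Kfun p = 0 ∧ S.KNfun p = 0) ↔ (S.afun p = 0 ∨ ∀ v : Pt, S.beta p v = 0)) := by
  intro p hp
  rw [CNND.Kfun_eq hp, CNND.KNfun_eq hp, neg_eq_zero]
  constructor
  · rintro ⟨h1, h2⟩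
    by_cases ha : S.afun p = 0
    · exact Or.inl ha
    · refine Or.inr fun v => ?_
      have hT := (mul_eq_zero.1 h1).resolve_left ha
      have hW := (mul_eq_zero.1 h2).resolve_left ha
      obtain ⟨x, y, rfl⟩ := exists_eq_smul_add_smul (S.hWorient p hp).ne' v
      rw [CNND.beta_eq_mink hp] at hT hW ⊢
      rw [map_add, map_smul, map_smul, mink_add_left, mink_smul_left, mink_smul_left, hT, hW]
      ring
  · rintro (h | h) <;> simp [h]

end
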